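/- Let 𝔠 = {C_1,…,C_M} (M ≥ 2) be pairwise-distinct binary linear codes of length n with minimum cross-code distance δ. Let i ∈ [M], let T ∈ F_2^{N×n} have all rows in C_i, let E ∈ F_2^{N×n} have every row of Hamming weight at most ⌊(δ−1)/2⌋, and set Y = T + E. If rank(T) ≥ N − ρ for some integer 0 ≤ ρ ≤ N, then D_i(Y) = T and Δ_SD(Y, C_i) = dim(C_i) − rank(T) ≤ max(dim(C_i) − N + ρ, 0). -/

import Mathlib

open Submodule Module

/-- The subspace distance between two subspaces. -/
noncomputable def sdist {F V : Type*} [Field F] [AddCommGroup V] [Module F V]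
    (U W : Submodule F V) : ℕ :=
  finrank F ↥(U ⊔ W) - finrank F ↥(U ⊓ W)

/-- The row space of a matrix. -/
def rowSpace {F : Type*} [Field F] {m n : Type*} (A : Matrix m n F) :
    Submodule F (n → F) :=
  Submodule.span F (Set.range fun r => A r)

/-- The minimum cross-code distance `δ` of a family of codes: the minimum Hamming distance
between any pair of distinct codewords taken from any two distinct codes of the family. -/
noncomputable def crossDist {M n : ℕ}
    (C : Fin M → Submodule (ZMod 2) (Fin n → ZMod 2)) : ℕ :=
  sInf {d | ∃ i j, i ≠ j ∧ ∃ c ∈ C i, ∃ c' ∈ C j, c ≠ c' ∧ d = hammingDist c c'}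

open Classical in
/-- The denoised vector of `y` with respect to a code `Cj` (relative to a distance
parameter `δ`): a codeword `c ∈ Cj` with `d_H(c,y) < δ/2` if one exists, else `y` itself. -/
noncomputable def denoise {n : ℕ} (δ : ℕ) (Cj : Submodule (ZMod 2) (Fin n → ZMod 2))
    (y : Fin n → ZMod 2) : Fin n → ZMod 2 :=
  if h : ∃ c ∈ Cj, 2 * hammingDist c y < δ then h.choose else y

/-- The denoised matrix `D_j(Y)`: the matrix obtained from `Y` by denoising each row
with respect to the code `Cj`. -/
noncomputable def denoiseMatrix {N n : ℕ} (δ : ℕ)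
    (Cj : Submodule (ZMod 2) (Fin n → ZMod 2)) (Y : Matrix (Fin N) (Fin n) (ZMod 2)) :
    Matrix (Fin N) (Fin n) (ZMod 2) :=
  Matrix.of fun r => denoise δ Cj (Y r)

/-- The denoised subspace discrepancy `Δ_SD(Y, Cj) = d_s(⟨D_j(Y)⟩, Cj)`. -/
noncomputable def discSD {N n : ℕ} (δ : ℕ)
    (Cj : Submodule (ZMod 2) (Fin n → ZMod 2)) (Y : Matrix (Fin N) (Fin n) (ZMod 2)) : ℕ :=
  sdist (rowSpace (denoiseMatrix δ Cj Y)) Cj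

/-- The cross distance bounds the distance of distinct words of a single code from below, since
the zero word lies in every other code. -/
theorem crossDist_le_hammingDist {M n : ℕ} (hM : 2 ≤ M)
    (C : Fin M → Submodule (ZMod 2) (Fin n → ZMod 2)) {i : Fin M} {a b : Fin n → ZMod 2}
    (ha : a ∈ C i) (hb : b ∈ C i) (hab : a ≠ b) : crossDist C ≤ hammingDist a b := by
  have : Nontrivial (Fin M) := Fin.nontrivial_iff_two_le.mpr hM
  obtain ⟨j, hj⟩ := exists_ne i
  refine Nat.sInf_le ⟨i, j, hj.symm, a - b, (C i).sub_mem ha hb, 0, (C j).zero_mem,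
    sub_ne_zero.mpr hab, ?_⟩
  rw [hammingDist_zero_right, hammingDist_comm, hammingDist_eq_hammingNorm, neg_add_eq_sub]

theorem crossDist_pos {M n : ℕ} (hM : 2 ≤ M)
    (C : Fin M → Submodule (ZMod 2) (Fin n → ZMod 2)) (hC : Function.Injective C) :
    0 < crossDist C := by
  have : Nontrivial (Fin M) := Fin.nontrivial_iff_two_le.mpr hM
  have hne : {d | ∃ i j, i ≠ j ∧ ∃ c ∈ C i, ∃ c' ∈ C j,
      c ≠ c' ∧ d = hammingDist c c'}.Nonempty := by
    obtain ⟨i, hi⟩ : ∃ i, C i ≠ ⊥ := by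
      by_contra! h
      obtain ⟨i, j, hij⟩ := exists_pair_ne (Fin M)
      exact hij (hC ((h i).trans (h j).symm))
    obtain ⟨c, hc, hc0⟩ := (C i).ne_bot_iff.mp hi
    obtain ⟨j, hj⟩ := exists_ne i
    exact ⟨_, i, j, hj.symm, c, hc, 0, (C j).zero_mem, hc0, rfl⟩
  obtain ⟨i, j, -, c, -, c', -, hcc, hd⟩ := Nat.sInf_mem hne
  rw [crossDist, hd]
  exact hammingDist_pos.mpr hcc

/-- Denoising returns any codeword within half the distance parameter, provided that the
parameter is at most the minimum distance of the code. -/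
theorem denoise_eq_of_two_mul_hammingDist_lt {n δ : ℕ}
    {D : Submodule (ZMod 2) (Fin n → ZMod 2)}
    (hD : ∀ a ∈ D, ∀ b ∈ D, a ≠ b → δ ≤ hammingDist a b)
    {t y : Fin n → ZMod 2} (ht : t ∈ D) (hty : 2 * hammingDist t y < δ) :
    denoise δ D y = t := by
  have h : ∃ c ∈ D, 2 * hammingDist c y < δ := ⟨t, ht, hty⟩
  rw [denoise, dif_pos h]
  by_contra hne
  have h₁ := hD _ h.choose_spec.1 _ ht hne
  have h₂ := hammingDist_triangle_right h.choose t y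
  have h₃ := h.choose_spec.2
  omega

theorem rank_eq_finrank_rowSpace {F m n : Type*} [Field F] [Fintype m] [Fintype n]
    (A : Matrix m n F) : A.rank = finrank F ↥(rowSpace A) :=
  A.rank_eq_finrank_span_row

theorem sdist_eq_of_le {F V : Type*} [Field F] [AddCommGroup V] [Module F V]
    {U W : Submodule F V} (h : U ≤ W) : sdist U W = finrank F ↥W - finrank F ↥U := by
  rw [sdist, sup_eq_right.mpr h, inf_eq_left.mpr h]

/-- If all rows of `T` lie in the true code `C_i`, every row of the error matrix `E` has
Hamming weight at most `⌊(δ−1)/2⌋`, `Y = T + E`, and `rank(T) ≥ N − ρ`, then denoising `Y`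
with respect to `C_i` recovers `T`, `Δ_SD(Y, C_i) = dim C_i − rank T`, and
`Δ_SD(Y, C_i) ≤ (dim C_i − N + ρ)₊`. -/
theorem discSD_true_code_eq {M n N : ℕ} (hM : 2 ≤ M)
    (C : Fin M → Submodule (ZMod 2) (Fin n → ZMod 2)) (hC : Function.Injective C)
    (i : Fin M) (T E Y : Matrix (Fin N) (Fin n) (ZMod 2))
    (hT : ∀ r, T r ∈ C i)
    (hE : ∀ r, hammingNorm (E r) ≤ (crossDist C - 1) / 2)
    (hY : Y = T + E)
    (ρ : ℕ) (hρ : ρ ≤ N) (hrank : N - ρ ≤ T.rank) :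
    denoiseMatrix (crossDist C) (C i) Y = T ∧
    discSD (crossDist C) (C i) Y = finrank (ZMod 2) ↥(C i) - T.rank ∧
    discSD (crossDist C) (C i) Y ≤ finrank (ZMod 2) ↥(C i) + ρ - N := by
  have hpos := crossDist_pos hM C hC
  have hden : denoiseMatrix (crossDist C) (C i) Y = T := by
    funext r
    refine denoise_eq_of_two_mul_hammingDist_lt
      (fun a ha b hb => crossDist_le_hammingDist hM C ha hb) (hT r) ?_
    have hdist : hammingDist (T r) (Y r) = hammingNorm (E r) := by
      rw [hammingDist_eq_hammingNorm, hY]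
      exact congrArg hammingNorm (neg_add_cancel_left (T r) (E r))
    have := hE r
    omega
  have hle : rowSpace T ≤ C i := span_le.mpr (Set.range_subset_iff.mpr hT)
  have hdisc : discSD (crossDist C) (C i) Y = finrank (ZMod 2) ↥(C i) - T.rank := by
    rw [discSD, hden, sdist_eq_of_le hle, rank_eq_finrank_rowSpace]
  exact ⟨hden, hdisc, by omega⟩
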